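/- arXiv:math/0209340 — 2 statements merged into one kernel-verified Lean document; each statement's English description precedes it below -/
import Mathlib

section
/- Fix k ≥ 1. For n ≥ 0 let a_n be the number of permutations of length n that avoid the classical pattern 2-1-3 and begin with the pattern 12⋯k (so a_n = 0 for n < k). Then in the ring of formal power series with integer coefficients, ∑_{n≥0} a_n x^n = x^k · C(x)^{k+1}. -/
/-- `π` avoids the classical pattern 2-1-3: there are no indices `i < j < k`
with `π j < π i < π k`. -/
def AvoidsC213 {n : ℕ} (π : Equiv.Perm (Fin n)) : Prop :=
  ¬ ∃ i j k : Fin n, i < j ∧ j < k ∧ π j < π i ∧ π i < π k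

/-- `π` begins with the pattern `12⋯k`: its first `k` letters are increasing
(in particular the length is at least `k`). -/
def BeginsInc {n : ℕ} (π : Equiv.Perm (Fin n)) (k : ℕ) : Prop :=
  k ≤ n ∧ ∀ i j : Fin n, i < j → (j : ℕ) < k → π i < π j

/-- The number of permutations of length `n` avoiding the classical pattern 2-1-3
and beginning with the pattern `12⋯k`. -/
noncomputable def a (k n : ℕ) : ℕ :=
  Nat.card {π : Equiv.Perm (Fin n) // AvoidsC213 π ∧ BeginsInc π k}

theorem glue_lt {i j : ℕ} (p : Fin (i+j+1)) (h0 : ¬ p.val = 0) (h : ¬ p.val - 1 < i) :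
    p.val - 1 - i < j := by omega

def glueFun {i j : ℕ} (σ : Equiv.Perm (Fin i)) (τ : Equiv.Perm (Fin j)) (p : Fin (i+j+1)) :
    Fin (i+j+1) :=
  if h0 : p.val = 0 then ⟨j, by omega⟩
  else if h : p.val - 1 < i then ⟨j + 1 + (σ ⟨p.val - 1, h⟩).val, by omega⟩
  else ⟨(τ ⟨p.val - 1 - i, glue_lt p h0 h⟩).val, by omega⟩

theorem glueFun_zero {i j : ℕ} (σ : Equiv.Perm (Fin i)) (τ : Equiv.Perm (Fin j)) :
    (glueFun σ τ 0).val = j := by simp [glueFun]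

theorem glueFun_left {i j : ℕ} (σ : Equiv.Perm (Fin i)) (τ : Equiv.Perm (Fin j)) (q : Fin i) :
    (glueFun σ τ ⟨q.val + 1, by omega⟩).val = j + 1 + (σ q).val := by simp [glueFun]

theorem glueFun_right {i j : ℕ} (σ : Equiv.Perm (Fin i)) (τ : Equiv.Perm (Fin j)) (q : Fin j) :
    (glueFun σ τ ⟨q.val + i + 1, by omega⟩).val = (τ q).val := by simp [glueFun]

theorem pos_cases {i j : ℕ} (p : Fin (i+j+1)) :
    p = 0 ∨ (∃ q : Fin i, p = ⟨q.val + 1, by omega⟩) ∨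
      (∃ q : Fin j, p = ⟨q.val + i + 1, by omega⟩) := by
  by_cases h0 : p.val = 0
  · left; ext; simpa using h0
  by_cases h : p.val - 1 < i
  · right; left; exact ⟨⟨p.val - 1, h⟩, by ext; simp; omega⟩
  · right; right; exact ⟨⟨p.val - 1 - i, by omega⟩, by ext; simp; omega⟩

theorem glueFun_inj {i j : ℕ} (σ : Equiv.Perm (Fin i)) (τ : Equiv.Perm (Fin j)) :
    Function.Injective (glueFun σ τ) := by
  intro p q h
  have h := congrArg Fin.val h
  rcases pos_cases p with rfl | ⟨p, rfl⟩ | ⟨p, rfl⟩ <;>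
  rcases pos_cases q with rfl | ⟨q, rfl⟩ | ⟨q, rfl⟩ <;>
  simp only [glueFun_zero, glueFun_left, glueFun_right] at h
  · rfl
  · omega
  · omega
  · omega
  · have : σ p = σ q := by ext; omega
    rw [σ.injective this]
  · omega
  · omega
  · omega
  · have : τ p = τ q := by ext; omega
    rw [τ.injective this]

noncomputable def glue {i j : ℕ} (σ : Equiv.Perm (Fin i)) (τ : Equiv.Perm (Fin j)) :
    Equiv.Perm (Fin (i+j+1)) :=
  Equiv.ofBijective (glueFun σ τ) (Finite.injective_iff_bijective.mp (glueFun_inj σ τ))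

theorem glue_zero {i j : ℕ} (σ : Equiv.Perm (Fin i)) (τ : Equiv.Perm (Fin j)) :
    (glue σ τ 0).val = j := glueFun_zero σ τ

theorem glue_left {i j : ℕ} (σ : Equiv.Perm (Fin i)) (τ : Equiv.Perm (Fin j)) (q : Fin i) :
    (glue σ τ ⟨q.val + 1, by omega⟩).val = j + 1 + (σ q).val := glueFun_left σ τ q

theorem glue_right {i j : ℕ} (σ : Equiv.Perm (Fin i)) (τ : Equiv.Perm (Fin j)) (q : Fin j) :
    (glue σ τ ⟨q.val + i + 1, by omega⟩).val = (τ q).val := glueFun_right σ τ q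

theorem glue_avoids {i j : ℕ} (σ : Equiv.Perm (Fin i)) (τ : Equiv.Perm (Fin j)) :
    AvoidsC213 (glue σ τ) ↔ AvoidsC213 σ ∧ AvoidsC213 τ := by
  constructor
  · intro h
    refine ⟨?_, ?_⟩
    · rintro ⟨x, y, z, h1, h2, h3, h4⟩
      refine h ⟨⟨x.val + 1, by omega⟩, ⟨y.val + 1, by omega⟩, ⟨z.val + 1, by omega⟩, ?_, ?_, ?_, ?_⟩ <;>
      simp only [Fin.lt_def, glue_left] at * <;> omega
    · rintro ⟨x, y, z, h1, h2, h3, h4⟩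
      refine h ⟨⟨x.val + i + 1, by omega⟩, ⟨y.val + i + 1, by omega⟩, ⟨z.val + i + 1, by omega⟩,
        ?_, ?_, ?_, ?_⟩ <;>
      simp only [Fin.lt_def, glue_right] at * <;> omega
  · rintro ⟨hσ, hτ⟩ ⟨x, y, z, h1, h2, h3, h4⟩
    rcases pos_cases x with rfl | ⟨x, rfl⟩ | ⟨x, rfl⟩ <;>
    rcases pos_cases y with rfl | ⟨y, rfl⟩ | ⟨y, rfl⟩ <;>
    rcases pos_cases z with rfl | ⟨z, rfl⟩ | ⟨z, rfl⟩ <;>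
    simp only [Fin.lt_def, glue_left, glue_right, glue_zero, Fin.val_zero] at h1 h2 h3 h4 <;>
    first
    | omega
    | exact hσ ⟨x, y, z, by omega, by omega, by omega, by omega⟩
    | exact hτ ⟨x, y, z, by omega, by omega, by omega, by omega⟩

theorem glue_begins {i j : ℕ} (σ : Equiv.Perm (Fin i)) (τ : Equiv.Perm (Fin j)) (k : ℕ) :
    BeginsInc (glue σ τ) (k+1) ↔ BeginsInc σ k := by
  constructor
  · rintro ⟨h1, h2⟩
    have hk : k ≤ i := by
      by_contra hc
      have := h2 0 ⟨0 + i + 1, by omega⟩ (by simp [Fin.lt_def]) (by simp; omega)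
      rw [Fin.lt_def, glue_zero, glue_right σ τ ⟨0, by omega⟩] at this
      omega
    refine ⟨hk, fun x y hxy hy => ?_⟩
    have := h2 ⟨x.val + 1, by omega⟩ ⟨y.val + 1, by omega⟩ (by rw [Fin.lt_def] at hxy ⊢; exact Nat.add_lt_add_right hxy 1)
      (by simpa using hy)
    rw [Fin.lt_def, glue_left, glue_left] at this
    omega
  · rintro ⟨h1, h2⟩
    refine ⟨by omega, fun x y hxy hy => ?_⟩
    rcases pos_cases x with rfl | ⟨x, rfl⟩ | ⟨x, rfl⟩ <;>
    rcases pos_cases y with rfl | ⟨y, rfl⟩ | ⟨y, rfl⟩ <;>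
    simp only [Fin.lt_def, glue_left, glue_right, glue_zero, Fin.val_zero] at hxy hy ⊢ <;>
    first
    | omega
    | (have := h2 x y (by omega) (by omega)
       omega)

theorem glue_struct {i j : ℕ} (π : Equiv.Perm (Fin (i+j+1))) (h0 : (π 0).val = j)
    (ha : AvoidsC213 π) (p : Fin (i+j+1)) (hp : p ≠ 0) :
    (p.val ≤ i → j < (π p).val) ∧ (i < p.val → (π p).val < j) := by
  have hne : ∀ q : Fin (i+j+1), q ≠ 0 → (π q).val ≠ j := by
    intro q hq h
    exact hq (π.injective (Fin.ext (h.trans h0.symm)))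
  have hdown : ∀ q r : Fin (i+j+1), q ≠ 0 → q < r → j < (π r).val → j < (π q).val := by
    intro q r hq hqr hr
    by_contra hc
    have := hne q hq
    refine ha ⟨0, q, r, Fin.pos_iff_ne_zero.mpr hq, hqr, ?_, ?_⟩ <;> rw [Fin.lt_def] <;> omega
  let S : Finset (Fin (i+j+1)) := (Finset.Ioi (π 0)).map π.symm.toEmbedding
  have hS : S.card = i := by
    simp only [S, Finset.card_map, Fin.card_Ioi]; omega
  have hmem : ∀ q, q ∈ S ↔ j < (π q).val := by
    intro q
    simp only [S, Finset.mem_map_equiv, Equiv.symm_symm, Finset.mem_Ioi, Fin.lt_def, h0]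
  have hp' : 0 < p.val := Fin.pos_iff_ne_zero.mpr hp
  constructor
  · intro hpi
    by_contra hc
    have hsub : S ⊆ Finset.Ioo 0 p := by
      intro q hq
      rw [hmem] at hq
      have hq0 : q ≠ 0 := by rintro rfl; omega
      rw [Finset.mem_Ioo]
      refine ⟨Fin.pos_iff_ne_zero.mpr hq0, ?_⟩
      by_contra hqp
      rcases eq_or_lt_of_le (not_lt.mp hqp) with h | h
      · subst h; exact hc hq
      · exact hc (hdown p q hp h hq)
    have := Finset.card_le_card hsub
    rw [hS, Fin.card_Ioo, Fin.val_zero] at this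
    omega
  · intro hpi
    by_contra hc
    have hc' : j < (π p).val := by have := hne p hp; omega
    have hsub : Finset.Ioc 0 p ⊆ S := by
      intro q hq
      rw [Finset.mem_Ioc] at hq
      rw [hmem]
      rcases eq_or_lt_of_le hq.2 with h | h
      · subst h; exact hc'
      · exact hdown q p (Fin.pos_iff_ne_zero.mp hq.1) h hc'
    have := Finset.card_le_card hsub
    rw [hS, Fin.card_Ioc, Fin.val_zero] at this
    omega

theorem glue_surj {i j : ℕ} (π : Equiv.Perm (Fin (i+j+1))) (h0 : (π 0).val = j)
    (ha : AvoidsC213 π) : ∃ (σ : Equiv.Perm (Fin i)) (τ : Equiv.Perm (Fin j)), glue σ τ = π := by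
  have hs := glue_struct π h0 ha
  have hl : ∀ q : Fin i, j < (π ⟨q.val + 1, by omega⟩).val := fun q =>
    (hs _ (by simp [Fin.ext_iff])).1 (by simp)
  have hr : ∀ q : Fin j, (π ⟨q.val + i + 1, by omega⟩).val < j := fun q =>
    (hs _ (by simp [Fin.ext_iff])).2 (by simp)
  let f : Fin i → Fin i := fun q => ⟨(π ⟨q.val + 1, by omega⟩).val - (j + 1), by
    have := hl q; omega⟩
  let g : Fin j → Fin j := fun q => ⟨(π ⟨q.val + i + 1, by omega⟩).val, hr q⟩
  have hf : Function.Injective f := by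
    intro x y h
    have h := congrArg Fin.val h
    simp only [f] at h
    have hx := hl x
    have hy := hl y
    have := π.injective (Fin.ext (show (π ⟨x.val + 1, by omega⟩).val = (π ⟨y.val + 1, by omega⟩).val by omega))
    simp only [Fin.mk.injEq] at this
    ext; omega
  have hg : Function.Injective g := by
    intro x y h
    have h := congrArg Fin.val h
    simp only [g] at h
    have := π.injective (Fin.ext h)
    simp only [Fin.mk.injEq] at this
    ext; omega
  refine ⟨Equiv.ofBijective f (Finite.injective_iff_bijective.mp hf),
    Equiv.ofBijective g (Finite.injective_iff_bijective.mp hg), ?_⟩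
  ext p
  rcases pos_cases p with rfl | ⟨p, rfl⟩ | ⟨p, rfl⟩
  · rw [glue_zero, h0]
  · rw [glue_left]
    have := hl p
    simp only [Equiv.ofBijective_apply, f]
    omega
  · rw [glue_right]
    simp only [Equiv.ofBijective_apply, g]

theorem begins_zero {n : ℕ} (π : Equiv.Perm (Fin n)) : BeginsInc π 0 :=
  ⟨Nat.zero_le _, fun _ _ _ h => absurd h (Nat.not_lt_zero _)⟩

theorem card_fiber (k i j : ℕ) :
    Nat.card {π : {π : Equiv.Perm (Fin (i+j+1)) // AvoidsC213 π ∧ BeginsInc π (k+1)} //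
      (π.1 0).val = j} = a k i * a 0 j := by
  rw [a, a, ← Nat.card_prod]
  symm
  refine Nat.card_eq_of_bijective (fun x => ⟨⟨glue x.1.1 x.2.1,
    (glue_avoids _ _).2 ⟨x.1.2.1, x.2.2.1⟩, (glue_begins _ _ _).2 x.1.2.2⟩, glue_zero _ _⟩) ⟨?_, ?_⟩
  · rintro ⟨⟨σ, h1⟩, ⟨τ, h2⟩⟩ ⟨⟨σ', h1'⟩, ⟨τ', h2'⟩⟩ h
    simp only [Subtype.mk.injEq] at h
    have e1 : σ = σ' := by
      ext q
      have := glue_left σ τ q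
      rw [h, glue_left] at this
      omega
    have e2 : τ = τ' := by
      ext q
      have := glue_right σ τ q
      rw [h, glue_right] at this
      omega
    subst e1 e2
    rfl
  · rintro ⟨⟨π, h1, h2⟩, h3⟩
    obtain ⟨σ, τ, rfl⟩ := glue_surj π h3 h1
    exact ⟨⟨⟨σ, ((glue_avoids _ _).1 h1).1, (glue_begins _ _ _).1 h2⟩,
      ⟨τ, ((glue_avoids _ _).1 h1).2, begins_zero τ⟩⟩, rfl⟩

theorem a_succ (k n : ℕ) : a (k+1) (n+1) = ∑ j : Fin (n+1), a 0 j * a k (n - j) := by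
  have key : ∀ j : Fin (n+1),
      Nat.card {π : {π : Equiv.Perm (Fin (n+1)) // AvoidsC213 π ∧ BeginsInc π (k+1)} //
        π.1 0 = j} = a 0 j * a k (n - j) := by
    rintro ⟨j, hj⟩
    obtain ⟨i, rfl⟩ : ∃ i, n = i + j := ⟨n - j, by omega⟩
    have := card_fiber k i j
    simp only [Fin.ext_iff, Nat.add_sub_cancel]
    rw [this, mul_comm]
  rw [a, ← Nat.card_congr (Equiv.sigmaFiberEquiv
    (fun π : {π : Equiv.Perm (Fin (n+1)) // AvoidsC213 π ∧ BeginsInc π (k+1)} => π.1 0)),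
    Nat.card_sigma]
  exact Finset.sum_congr rfl fun j _ => key j

theorem a_succ_zero (k : ℕ) : a (k+1) 0 = 0 := by
  rw [a]
  have : IsEmpty {π : Equiv.Perm (Fin 0) // AvoidsC213 π ∧ BeginsInc π (k+1)} :=
    ⟨fun x => by have := x.2.2.1; omega⟩
  exact Nat.card_of_isEmpty

theorem a_zero_zero : a 0 0 = 1 := by
  rw [a, Nat.card_eq_one_iff_unique]
  exact ⟨⟨fun x y => Subtype.ext (Subsingleton.elim _ _)⟩,
    ⟨⟨1, fun ⟨x, _⟩ => x.elim0, begins_zero _⟩⟩⟩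

theorem a_one (n : ℕ) : a 0 (n+1) = a 1 (n+1) := by
  rw [a, a]
  refine Nat.card_congr (Equiv.subtypeEquivRight fun π => ?_)
  refine and_congr_right fun _ => ⟨fun _ => ⟨by omega, fun x y h hy => ?_⟩, fun _ => begins_zero _⟩
  rw [Fin.lt_def] at h
  omega

theorem a_zero (n : ℕ) : a 0 n = catalan n := by
  induction n using Nat.strong_induction_on with
  | _ n ih =>
    cases n with
    | zero => rw [a_zero_zero, catalan_zero]
    | succ n =>
      rw [a_one, a_succ, catalan_succ]
      refine Finset.sum_congr rfl fun j _ => ?_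
      rw [ih j (by omega), ih (n - j) (by omega)]

theorem gf_succ (k : ℕ) : PowerSeries.mk (fun n => (a (k+1) n : ℤ))
    = PowerSeries.X * ((PowerSeries.mk fun n => (catalan n : ℤ)) *
      PowerSeries.mk (fun n => (a k n : ℤ))) := by
  ext n
  cases n with
  | zero => simp [a_succ_zero]
  | succ n =>
    rw [PowerSeries.coeff_succ_X_mul, PowerSeries.coeff_mul, PowerSeries.coeff_mk, a_succ]
    simp only [PowerSeries.coeff_mk, a_zero]
    rw [Finset.Nat.sum_antidiagonal_eq_sum_range_succ
      (fun x y => (catalan x : ℤ) * (a k y : ℤ)), Finset.sum_range]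
    push_cast
    rfl

theorem avoidC213_beginInc_gf (k : ℕ) (hk : 1 ≤ k) :
    PowerSeries.mk (fun n => (a k n : ℤ))
      = PowerSeries.X ^ k * (PowerSeries.mk fun n => (catalan n : ℤ)) ^ (k + 1) := by
  clear hk
  induction k with
  | zero => simp [a_zero]
  | succ k ih => rw [gf_succ, ih]; ring
end

section
/- For m ≥ 1 and 1 ≤ t ≤ m, let s_m(t) denote the number of permutations of length m that avoid the classical pattern 1-2-3 and whose first letter is t. Then for all n ≥ k ≥ 1, the number of permutations of length n that avoid the classical pattern 1-2-3 and begin with the pattern k(k-1)⋯1 equals ∑_{t=1}^{n+1-k} binom(n-t, k-1) · s_{n-k+1}(t). -/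
/-- `π` avoids the classical pattern 1-2-3: there are no indices `i < j < k`
with `π i < π j < π k`. -/
def AvoidsC123 {n : ℕ} (π : Equiv.Perm (Fin n)) : Prop :=
  ¬ ∃ i j k : Fin n, i < j ∧ j < k ∧ π i < π j ∧ π j < π k

/-- `π` begins with the pattern `k(k-1)⋯1`: its first `k` letters are decreasing
(in particular the length is at least `k`). -/
def BeginsDec {n : ℕ} (π : Equiv.Perm (Fin n)) (k : ℕ) : Prop :=
  k ≤ n ∧ ∀ i j : Fin n, i < j → (j : ℕ) < k → π j < π i

/-- `sF m t` is the number of permutations of length `m` avoiding the classical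
pattern 1-2-3 whose first letter is `t` (letters being `1, …, m`). -/
noncomputable def sF (m t : ℕ) : ℕ :=
  Nat.card {π : Equiv.Perm (Fin m) //
    AvoidsC123 π ∧ ∃ h : 0 < m, ((π ⟨0, h⟩ : Fin m) : ℕ) + 1 = t}

noncomputable def phiA {j m : ℕ} (S : Finset (Fin (j + m))) (hS : S.card = j)
    (hc : Sᶜ.card = m) (σ : Equiv.Perm (Fin m)) : Equiv.Perm (Fin (j + m)) :=
  (finSumFinEquiv.symm.trans (Equiv.sumCongr Fin.revPerm σ)).trans (finSumEquivOfFinset hS hc)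

theorem phiA_left {j m : ℕ} (S : Finset (Fin (j + m))) (hS : S.card = j)
    (hc : Sᶜ.card = m) (σ : Equiv.Perm (Fin m)) (i : Fin j) :
    phiA S hS hc σ (Fin.castAdd m i) = S.orderEmbOfFin hS i.rev := by
  simp [phiA]

theorem phiA_right {j m : ℕ} (S : Finset (Fin (j + m))) (hS : S.card = j)
    (hc : Sᶜ.card = m) (σ : Equiv.Perm (Fin m)) (i : Fin m) :
    phiA S hS hc σ (Fin.natAdd j i) = Sᶜ.orderEmbOfFin hc (σ i) := by
  simp [phiA]

theorem phiA_image {j m : ℕ} (S : Finset (Fin (j + m))) (hS : S.card = j)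
    (hc : Sᶜ.card = m) (σ : Equiv.Perm (Fin m)) (x : Fin (j + m)) :
    x ∈ S ↔ ∃ i : Fin j, phiA S hS hc σ (Fin.castAdd m i) = x := by
  simp only [phiA_left]
  have h := Finset.range_orderEmbOfFin S hS
  rw [← Finset.mem_coe, ← h]
  constructor
  · rintro ⟨i, rfl⟩
    exact ⟨i.rev, by simp⟩
  · rintro ⟨i, rfl⟩
    exact ⟨_, rfl⟩

theorem phiA_inj {j m : ℕ} (S S' : Finset (Fin (j + m))) (hS : S.card = j)
    (hc : Sᶜ.card = m) (hS' : S'.card = j) (hc' : S'ᶜ.card = m) (σ σ' : Equiv.Perm (Fin m))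
    (h : phiA S hS hc σ = phiA S' hS' hc' σ') : S = S' ∧ σ = σ' := by
  have h1 : S = S' := by
    ext x
    rw [phiA_image S hS hc σ, phiA_image S' hS' hc' σ', h]
  subst h1
  refine ⟨rfl, ?_⟩
  ext i
  have := congrArg (fun f => f (Fin.natAdd j i)) h
  simp only [phiA_right] at this
  rw [(Sᶜ.orderEmbOfFin hc).injective this]

theorem phiA_surj {j m : ℕ} (π : Equiv.Perm (Fin (j + m)))
    (hd : ∀ a b : Fin j, a < b → π (Fin.castAdd m b) < π (Fin.castAdd m a)) :
    ∃ (S : Finset (Fin (j + m))) (hS : S.card = j) (hc : Sᶜ.card = m) (σ : Equiv.Perm (Fin m)),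
      phiA S hS hc σ = π := by
  classical
  let S : Finset (Fin (j + m)) := Finset.univ.image (fun i : Fin j => π (Fin.castAdd m i))
  have hS : S.card = j := by
    rw [Finset.card_image_of_injective]
    · simp
    · intro a b hab
      simpa using hab
  have hc : Sᶜ.card = m := by
    rw [Finset.card_compl, hS]; simp
  have hr : ∀ i : Fin m, π (Fin.natAdd j i) ∈ Sᶜ := by
    intro i
    simp only [S, Finset.mem_compl, Finset.mem_image, Finset.mem_univ, true_and, not_exists]
    intro a ha
    have := π.injective ha
    have := congrArg Fin.val this
    simp at this
    omega
  let f : Fin m → Fin m := fun i => (Sᶜ.orderIsoOfFin hc).symm ⟨π (Fin.natAdd j i), hr i⟩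
  have hf : Function.Injective f := by
    intro a b hab
    have := (Sᶜ.orderIsoOfFin hc).symm.injective hab
    simpa using this
  refine ⟨S, hS, hc, Equiv.ofBijective f (Finite.injective_iff_bijective.mp hf), ?_⟩
  ext1 x
  refine Fin.addCases (fun i => ?_) (fun i => ?_) x
  · rw [phiA_left]
    have := Finset.orderEmbOfFin_unique hS (f := fun i : Fin j => π (Fin.castAdd m i.rev))
      (fun i => Finset.mem_image_of_mem _ (Finset.mem_univ _))
      (fun a b hab => hd _ _ (Fin.rev_lt_rev.mpr hab))
    rw [← this]; simp
  · rw [phiA_right]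
    simp only [Equiv.ofBijective_apply, f, ← Finset.coe_orderIsoOfFin_apply,
      OrderIso.apply_symm_apply]

theorem emb_lt_iff {j m : ℕ} (S : Finset (Fin (j + m)))
    (hc : Sᶜ.card = m) (t : Fin m) :
    (∀ x ∈ S, Sᶜ.orderEmbOfFin hc t < x) ↔ ∀ x ∈ S, (t : ℕ) < x := by
  classical
  have hcard : ((Finset.Iio t).image (Sᶜ.orderEmbOfFin hc)).card = t := by
    rw [Finset.card_image_of_injective _ (Sᶜ.orderEmbOfFin hc).injective]; simp
  constructor
  · intro h x hx
    have h1 : (t : ℕ) ≤ Sᶜ.orderEmbOfFin hc t := by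
      have : (Finset.Iio t).image (Sᶜ.orderEmbOfFin hc) ⊆ Finset.Iio (Sᶜ.orderEmbOfFin hc t) := by
        intro y
        simp only [Finset.mem_image, Finset.mem_Iio]
        rintro ⟨i, hi, rfl⟩
        exact (Sᶜ.orderEmbOfFin hc).strictMono hi
      have := Finset.card_le_card this
      rw [hcard] at this
      simpa using this
    have := h x hx
    omega
  · intro h x hx
    by_contra hcon
    push Not at hcon
    have htx := h x hx
    have hsub : Finset.Iic (⟨t, by omega⟩ : Fin (j + m)) ⊆
        (Finset.Iio t).image (Sᶜ.orderEmbOfFin hc) := by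
      intro y hy
      have hy' : (y : ℕ) ≤ t := by simpa [Fin.le_def] using hy
      have hyS : y ∈ Sᶜ := by
        rw [Finset.mem_compl]
        intro hyS
        have := h y hyS
        omega
      have : y ∈ Set.range (Sᶜ.orderEmbOfFin hc) := by
        rw [Finset.range_orderEmbOfFin]; exact hyS
      obtain ⟨i, rfl⟩ := this
      rw [Finset.mem_image]
      refine ⟨i, ?_, rfl⟩
      rw [Finset.mem_Iio, ← (Sᶜ.orderEmbOfFin hc).lt_iff_lt]
      omega
    have := Finset.card_le_card hsub
    rw [hcard] at this
    simp at this

theorem phiA_cond {j m : ℕ} (S : Finset (Fin (j + (m + 1)))) (hS : S.card = j)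
    (hc : Sᶜ.card = m + 1) (σ : Equiv.Perm (Fin (m + 1))) :
    (AvoidsC123 (phiA S hS hc σ) ∧ BeginsDec (phiA S hS hc σ) (j + 1)) ↔
      (AvoidsC123 σ ∧ ∀ x ∈ S, ((σ 0 : Fin (m + 1)) : ℕ) < x) := by
  rw [← emb_lt_iff S hc]
  have hL : ∀ a b : Fin j, phiA S hS hc σ (Fin.castAdd (m + 1) a) <
      phiA S hS hc σ (Fin.castAdd (m + 1) b) ↔ b < a := by
    intro a b
    rw [phiA_left, phiA_left, OrderEmbedding.lt_iff_lt, Fin.rev_lt_rev]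
  have hR : ∀ a b : Fin (m + 1), phiA S hS hc σ (Fin.natAdd j a) <
      phiA S hS hc σ (Fin.natAdd j b) ↔ σ a < σ b := by
    intro a b
    rw [phiA_right, phiA_right, OrderEmbedding.lt_iff_lt]
  rw [← phiA_right S hS hc σ]
  have hI := phiA_image S hS hc σ
  generalize phiA S hS hc σ = π at *
  constructor
  · rintro ⟨hA, -, hB⟩
    constructor
    · rintro ⟨a, b, c, hab, hbc, h1, h2⟩
      exact hA ⟨Fin.natAdd j a, Fin.natAdd j b, Fin.natAdd j c, by simpa using hab,
        by simpa using hbc, (hR _ _).2 h1, (hR _ _).2 h2⟩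
    · intro x hx
      obtain ⟨i, rfl⟩ := (hI x).1 hx
      apply hB
      · simp [Fin.lt_def]
      · simp
  · rintro ⟨hA, hB⟩
    have hB' : ∀ i : Fin j, π (Fin.natAdd j 0) < π (Fin.castAdd (m + 1) i) :=
      fun i => hB _ ((hI _).2 ⟨i, rfl⟩)
    have hD : ∀ a b : Fin (j + (m + 1)), a < b → (b : ℕ) < j + 1 → π b < π a := by
      intro a b
      refine Fin.addCases (fun a => ?_) (fun a => ?_) a <;>
      refine Fin.addCases (fun b => ?_) (fun b => ?_) b
      · intro hab _
        exact (hL _ _).2 (by rw [Fin.lt_def] at hab ⊢; simpa using hab)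
      · intro hab hb
        have : b = 0 := by
          ext; simp at hb ⊢; omega
        subst this
        exact hB' a
      · intro hab hb
        simp [Fin.lt_def] at hab; omega
      · intro hab hb
        rw [Fin.lt_def] at hab
        simp only [Fin.val_natAdd] at hab hb; omega
    refine ⟨?_, by omega, hD⟩
    rintro ⟨a, b, c, hab, hbc, h1, h2⟩
    have hb : j + 1 ≤ (b : ℕ) := by
      by_contra hb
      exact absurd (hD a b hab (by omega)) (not_lt.2 h1.le)
    obtain ⟨a', ha', h1'⟩ : ∃ a' : Fin (m + 1), Fin.natAdd j a' < b ∧ π (Fin.natAdd j a') < π b := by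
      revert hab h1
      refine Fin.addCases (fun a => ?_) (fun a => ?_) a
      · intro _ h1
        exact ⟨0, by simp [Fin.lt_def]; omega, (hB' a).trans h1⟩
      · intro h h1
        exact ⟨a, h, h1⟩
    have e : ∀ x : Fin (j + (m + 1)), j ≤ (x : ℕ) → ∃ y, x = Fin.natAdd j y := by
      intro x hx
      exact ⟨⟨x - j, by omega⟩, by ext; simp; omega⟩
    obtain ⟨b, rfl⟩ := e b (by omega)
    obtain ⟨c, rfl⟩ := e c (by rw [Fin.lt_def] at hbc; omega)
    exact hA ⟨a', b, c, by simpa using ha', by simpa using hbc, (hR _ _).1 h1', (hR _ _).1 h2⟩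

theorem card_S (N j t : ℕ) :
    Nat.card {S : Finset (Fin N) // S.card = j ∧ ∀ x ∈ S, t < (x : ℕ)} = (N - (t + 1)).choose j := by
  classical
  have hcard : (Finset.univ.filter (fun x : Fin N => t < (x : ℕ))).card = N - (t + 1) := by
    rw [← Finset.card_map Fin.valEmbedding]
    rw [← Nat.card_Ico]
    congr 1
    ext x
    simp only [Finset.mem_map, Finset.mem_filter, Finset.mem_univ, true_and, Finset.mem_Ico,
      Fin.valEmbedding_apply]
    constructor
    · rintro ⟨a, ha, rfl⟩
      omega
    · intro h
      exact ⟨⟨x, h.2⟩, h.1, rfl⟩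
  rw [← hcard, ← Finset.card_powersetCard, ← Nat.card_eq_finsetCard]
  refine Nat.card_congr (Equiv.subtypeEquivRight ?_)
  intro S
  simp only [Finset.mem_powersetCard, Finset.subset_iff, Finset.mem_filter, Finset.mem_univ,
    true_and]
  exact and_comm

theorem mainA (j m : ℕ) :
    Nat.card {π : Equiv.Perm (Fin (j + (m + 1))) // AvoidsC123 π ∧ BeginsDec π (j + 1)}
      = ∑ t ∈ Finset.Icc 1 (m + 1), Nat.choose (j + (m + 1) - t) j * sF (m + 1) t := by
  classical
  have hcc : ∀ S : Finset (Fin (j + (m + 1))), S.card = j → Sᶜ.card = m + 1 := by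
    intro S hS
    rw [Finset.card_compl, hS]; simp
  let F : (Σ σ : {σ : Equiv.Perm (Fin (m + 1)) // AvoidsC123 σ},
      {S : Finset (Fin (j + (m + 1))) // S.card = j ∧ ∀ x ∈ S, ((σ.1 0 : Fin (m + 1)) : ℕ) < x}) →
      {π : Equiv.Perm (Fin (j + (m + 1))) // AvoidsC123 π ∧ BeginsDec π (j + 1)} :=
    fun p => ⟨phiA p.2.1 p.2.2.1 (hcc _ p.2.2.1) p.1.1,
      (phiA_cond _ _ _ _).2 ⟨p.1.2, p.2.2.2⟩⟩
  have hF : Function.Bijective F := by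
    constructor
    · rintro ⟨⟨σ, hσ⟩, ⟨S, hS⟩⟩ ⟨⟨σ', hσ'⟩, ⟨S', hS'⟩⟩ h
      have h' := congrArg Subtype.val h
      obtain ⟨rfl, rfl⟩ := phiA_inj _ _ _ _ _ _ _ _ h'
      rfl
    · rintro ⟨π, hπ⟩
      obtain ⟨S, hS, hc, σ, rfl⟩ := phiA_surj π (fun a b hab => hπ.2.2 _ _
        (by rw [Fin.lt_def] at hab ⊢; simpa using hab) (by rw [Fin.val_castAdd]; omega))
      have := (phiA_cond _ _ _ _).1 hπ
      exact ⟨⟨⟨σ, this.1⟩, ⟨S, hS, this.2⟩⟩, rfl⟩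
  rw [← Nat.card_eq_of_bijective F hF, Nat.card_sigma]
  simp only [card_S]
  rw [← Finset.sum_fiberwise_of_maps_to (t := Finset.Icc 1 (m + 1))
    (g := fun σ : {σ : Equiv.Perm (Fin (m + 1)) // AvoidsC123 σ} => ((σ.1 0 : Fin (m + 1)) : ℕ) + 1)
    (by intro x _; simp only [Finset.mem_Icc]; omega)]
  refine Finset.sum_congr rfl fun t ht => ?_
  rw [Finset.sum_congr rfl (g := fun _ => (j + (m + 1) - t).choose j)
    (by intro x hx; rw [(Finset.mem_filter.1 hx).2])]
  rw [Finset.sum_const, smul_eq_mul, mul_comm]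
  congr 1
  rw [sF, ← Fintype.card_subtype, ← Nat.card_eq_fintype_card]
  refine Nat.card_congr ((Equiv.subtypeSubtypeEquivSubtypeInter (fun σ => AvoidsC123 σ)
      (fun σ : Equiv.Perm (Fin (m + 1)) => ((σ 0 : Fin (m + 1)) : ℕ) + 1 = t)).trans
    (Equiv.subtypeEquivRight ?_))
  intro σ
  simp

theorem avoidC123_beginDec_count (n k : ℕ) (hk : 1 ≤ k) (hkn : k ≤ n) :
    Nat.card {π : Equiv.Perm (Fin n) // AvoidsC123 π ∧ BeginsDec π k}
      = ∑ t ∈ Finset.Icc 1 (n + 1 - k), Nat.choose (n - t) (k - 1) * sF (n - k + 1) t := by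
  obtain ⟨j, rfl⟩ : ∃ j, k = j + 1 := ⟨k - 1, by omega⟩
  obtain ⟨m, rfl⟩ : ∃ m, n = j + (m + 1) := ⟨n - (j + 1), by omega⟩
  have h1 : j + (m + 1) + 1 - (j + 1) = m + 1 := by omega
  have h2 : j + (m + 1) - (j + 1) + 1 = m + 1 := by omega
  rw [mainA, h1, h2, Nat.add_sub_cancel]
end
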